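/- arXiv:2002.01006 — 5 statements merged into one kernel-verified Lean document; each statement's English description precedes it below -/
import Mathlib

section
/- Let π: ℍ → ℍ be the Hopf map π(q) := q̃·q. Then π maps the unit 3-sphere S³ = {q ∈ ℍ : |q| = 1} onto the 2-sphere S² = {q ∈ S³ : the i-component of q is 0}; that is, for every q ∈ S³ one has |π(q)| = 1 and the i-component of π(q) vanishes, and conversely every point of S² is of the form π(q) for some q ∈ S³. -/
noncomputable section

/-- The ℝ-linear involution of ℍ fixing 1, j, k and sending i to −i. -/
def Iinv (q : Quaternion ℝ) : Quaternion ℝ := ⟨q.re, -q.imI, q.imJ, q.imK⟩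

/-- The Hopf map π(q) = q̃ · q. -/
def hopfMap (q : Quaternion ℝ) : Quaternion ℝ := Iinv q * q

theorem Quaternion.norm_eq_one_iff (q : Quaternion ℝ) :
    ‖q‖ = 1 ↔ q.re ^ 2 + q.imI ^ 2 + q.imJ ^ 2 + q.imK ^ 2 = 1 := by
  rw [← Quaternion.normSq_def', Quaternion.normSq_eq_norm_mul_self, ← sq,
    pow_eq_one_iff_of_nonneg (norm_nonneg q) two_ne_zero]

theorem Quaternion.exists_components_eq (a b c d : ℝ) :
    ∃ q : Quaternion ℝ, q.re = a ∧ q.imI = b ∧ q.imJ = c ∧ q.imK = d :=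
  ⟨⟨a, b, c, d⟩, rfl, rfl, rfl, rfl⟩

theorem re_Iinv (q : Quaternion ℝ) : (Iinv q).re = q.re := rfl

theorem imI_Iinv (q : Quaternion ℝ) : (Iinv q).imI = -q.imI := rfl

theorem imJ_Iinv (q : Quaternion ℝ) : (Iinv q).imJ = q.imJ := rfl

theorem imK_Iinv (q : Quaternion ℝ) : (Iinv q).imK = q.imK := rfl

theorem norm_Iinv_eq_one {q : Quaternion ℝ} (hq : ‖q‖ = 1) : ‖Iinv q‖ = 1 := by
  rw [Quaternion.norm_eq_one_iff] at hq ⊢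
  rwa [re_Iinv, imI_Iinv, imJ_Iinv, imK_Iinv, neg_sq]

theorem re_hopfMap (q : Quaternion ℝ) :
    (hopfMap q).re = q.re ^ 2 + q.imI ^ 2 - q.imJ ^ 2 - q.imK ^ 2 := by
  rw [hopfMap, Quaternion.re_mul, re_Iinv, imI_Iinv, imJ_Iinv, imK_Iinv]
  ring

theorem imI_hopfMap (q : Quaternion ℝ) : (hopfMap q).imI = 0 := by
  rw [hopfMap, Quaternion.imI_mul, re_Iinv, imI_Iinv, imJ_Iinv, imK_Iinv]
  ring

theorem imJ_hopfMap (q : Quaternion ℝ) :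
    (hopfMap q).imJ = 2 * (q.re * q.imJ + q.imI * q.imK) := by
  rw [hopfMap, Quaternion.imJ_mul, re_Iinv, imI_Iinv, imJ_Iinv, imK_Iinv]
  ring

theorem imK_hopfMap (q : Quaternion ℝ) :
    (hopfMap q).imK = 2 * (q.re * q.imK - q.imI * q.imJ) := by
  rw [hopfMap, Quaternion.imK_mul, re_Iinv, imI_Iinv, imJ_Iinv, imK_Iinv]
  ring

/-- The Hopf map sends the unit 3-sphere onto the 2-sphere of unit quaternions
with vanishing i-component. -/
theorem hopfMap_maps_S3_onto_S2 :
    (∀ q : Quaternion ℝ, ‖q‖ = 1 → ‖hopfMap q‖ = 1 ∧ (hopfMap q).imI = 0) ∧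
    (∀ p : Quaternion ℝ, ‖p‖ = 1 → p.imI = 0 →
      ∃ q : Quaternion ℝ, ‖q‖ = 1 ∧ hopfMap q = p) := by
  refine ⟨fun q hq => ⟨?_, imI_hopfMap q⟩, fun p hp hi => ?_⟩
  · rw [hopfMap, norm_mul, norm_Iinv_eq_one hq, hq, one_mul]
  rw [Quaternion.norm_eq_one_iff, hi] at hp
  by_cases hr : p.re = -1
  · rw [hr] at hp
    have hj : p.imJ = 0 := by nlinarith [sq_nonneg p.imJ, sq_nonneg p.imK]
    have hk : p.imK = 0 := by nlinarith [sq_nonneg p.imJ, sq_nonneg p.imK]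
    obtain ⟨q, h₀, h₁, h₂, h₃⟩ := Quaternion.exists_components_eq 0 0 1 0
    refine ⟨q, ?_, ?_⟩
    · rw [Quaternion.norm_eq_one_iff, h₀, h₁, h₂, h₃]
      norm_num
    · apply Quaternion.ext <;>
        simp only [re_hopfMap, imI_hopfMap, imJ_hopfMap, imK_hopfMap,
          h₀, h₁, h₂, h₃, hr, hi, hj, hk] <;>
        norm_num
  · have hpos : 0 < (1 + p.re) / 2 := by
      have : -1 ≤ p.re := by nlinarith [sq_nonneg p.imJ, sq_nonneg p.imK]
      have := lt_of_le_of_ne this (Ne.symm hr)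
      linarith
    obtain ⟨a, ha, hsq⟩ : ∃ a : ℝ, a ≠ 0 ∧ a ^ 2 = (1 + p.re) / 2 :=
      ⟨√((1 + p.re) / 2), (Real.sqrt_pos.2 hpos).ne', Real.sq_sqrt hpos.le⟩
    have hre : p.re = 2 * a ^ 2 - 1 := by linarith
    have hsum : (p.imJ / (2 * a)) ^ 2 + (p.imK / (2 * a)) ^ 2 = 1 - a ^ 2 := by
      rw [hre] at hp
      field_simp
      linear_combination hp
    obtain ⟨q, h₀, h₁, h₂, h₃⟩ :=
      Quaternion.exists_components_eq a 0 (p.imJ / (2 * a)) (p.imK / (2 * a))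
    refine ⟨q, ?_, ?_⟩
    · rw [Quaternion.norm_eq_one_iff, h₀, h₁, h₂, h₃]
      linear_combination hsum
    · apply Quaternion.ext
      · rw [re_hopfMap, h₀, h₁, h₂, h₃]
        linear_combination -hsum - hre
      · rw [imI_hopfMap, hi]
      · rw [imJ_hopfMap, h₀, h₁, h₂, h₃]
        field_simp
        ring
      · rw [imK_hopfMap, h₀, h₁, h₂, h₃]
        field_simp
        ring
end
end

section
/- Let η, u ∈ ℍ be quaternions with |η| = 1, |u| = 1, and u ∈ span{j,k} (the real part and i-component of u vanish), and let φ ∈ ℝ. Set X := e^{iφ}·η and N := i·u·e^{−iφ}·η. Then I(N)·X + I(X)·N = 2·I(η)·i·u·η; that is, the differential of the Hopf map at X applied to the unit normal N equals twice the rotated quaternion η̃·i·u·η. -/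
noncomputable section

/-- The quaternion i. -/
def qi : Quaternion ℝ := ⟨0, 1, 0, 0⟩

/-- The quaternion e^{iφ} = cos φ + (sin φ)·i. -/
def expI (φ : ℝ) : Quaternion ℝ := ⟨Real.cos φ, Real.sin φ, 0, 0⟩

/-- The quaternion e^{−iφ} = cos φ − (sin φ)·i. -/
def expMI (φ : ℝ) : Quaternion ℝ := ⟨Real.cos φ, -Real.sin φ, 0, 0⟩

theorem Iinv_mul (p q : Quaternion ℝ) : Iinv (p * q) = Iinv q * Iinv p := by
  ext <;>
    simp only [Quaternion.re_mul, Quaternion.imI_mul, Quaternion.imJ_mul,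
      Quaternion.imK_mul] <;>
    simp only [Iinv, Quaternion.re_mul, Quaternion.imI_mul, Quaternion.imJ_mul,
      Quaternion.imK_mul] <;>
    ring

theorem Iinv_expI (φ : ℝ) : Iinv (expI φ) = expMI φ := by
  ext <;> simp [Iinv, expI, expMI]

theorem Iinv_expMI (φ : ℝ) : Iinv (expMI φ) = expI φ := by
  ext <;> simp [Iinv, expI, expMI]

theorem expI_mul_Iinv_qi_mul_mul_expI (u : Quaternion ℝ) (φ : ℝ)
    (hure : u.re = 0) (huI : u.imI = 0) :
    expI φ * (Iinv u * Iinv qi) * expI φ = qi * u := by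
  have h := Real.sin_sq_add_cos_sq φ
  ext <;>
    simp only [Quaternion.re_mul, Quaternion.imI_mul, Quaternion.imJ_mul,
      Quaternion.imK_mul] <;>
    simp only [Iinv, qi, expI, hure, huI]
  · ring
  · ring
  · linear_combination -u.imK * h
  · linear_combination u.imJ * h

theorem expMI_mul_qi_mul_mul_expMI (u : Quaternion ℝ) (φ : ℝ)
    (hure : u.re = 0) (huI : u.imI = 0) :
    expMI φ * (qi * u) * expMI φ = qi * u := by
  have h := Real.sin_sq_add_cos_sq φ
  ext <;>
    simp only [Quaternion.re_mul, Quaternion.imI_mul, Quaternion.imJ_mul,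
      Quaternion.imK_mul] <;>
    simp only [qi, expMI, hure, huI]
  · ring
  · ring
  · linear_combination -u.imK * h
  · linear_combination u.imJ * h

/-- The differential of the Hopf map at X = e^{iφ}·η applied to the unit
normal N = i·u·e^{−iφ}·η equals 2·η̃·i·u·η. -/
theorem hopf_differential_unit_normal
    (η u : Quaternion ℝ) (φ : ℝ)
    (hη : ‖η‖ = 1) (hu : ‖u‖ = 1) (hure : u.re = 0) (huI : u.imI = 0) :
    Iinv (qi * u * expMI φ * η) * (expI φ * η)
      + Iinv (expI φ * η) * (qi * u * expMI φ * η)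
      = 2 * (Iinv η * qi * u * η) := by
  have h₁ := expI_mul_Iinv_qi_mul_mul_expI u φ hure huI
  have h₂ := expMI_mul_qi_mul_mul_expMI u φ hure huI
  calc
    _ = Iinv η * (expI φ * (Iinv u * Iinv qi) * expI φ) * η
        + Iinv η * (expMI φ * (qi * u) * expMI φ) * η := by
      simp only [Iinv_mul, Iinv_expI, Iinv_expMI, mul_assoc]
    _ = 2 * (Iinv η * qi * u * η) := by
      rw [h₁, h₂, two_mul]
      simp only [mul_assoc]
end
end

section
/- Let η, u ∈ ℍ be quaternions with |η| = 1, |u| = 1, and u ∈ span{j,k} (the real part and i-component of u vanish). Then conj(I(η)·i·u·η)·(I(η)·u·η) = conj(η)·i·η, and Re(conj(η)·i·η) = 0. Consequently the quaternion I(η)·i·u·η is a unit vector orthogonal (with respect to the real inner product Re(conj(·)·(·))) to I(η)·u·η. -/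
noncomputable section

@[simp] theorem qi_re : qi.re = 0 := rfl

@[simp] theorem qi_imI : qi.imI = 1 := rfl

@[simp] theorem qi_imJ : qi.imJ = 0 := rfl

@[simp] theorem qi_imK : qi.imK = 0 := rfl

theorem star_qi : star qi = -qi := by
  ext <;> simp

theorem norm_qi : ‖qi‖ = 1 := by
  rw [← sq_eq_sq₀ (norm_nonneg _) zero_le_one, sq, ← Quaternion.normSq_eq_norm_mul_self,
    Quaternion.normSq_def']
  simp

theorem norm_Iinv (q : Quaternion ℝ) : ‖Iinv q‖ = ‖q‖ := by
  rw [← sq_eq_sq₀ (norm_nonneg _) (norm_nonneg _), sq, sq, ← Quaternion.normSq_eq_norm_mul_self,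
    ← Quaternion.normSq_eq_norm_mul_self, Quaternion.normSq_def', Quaternion.normSq_def']
  simp [Iinv]

theorem star_mul_self_of_norm_eq_one {q : Quaternion ℝ} (hq : ‖q‖ = 1) : star q * q = 1 := by
  rw [Quaternion.star_mul_self, Quaternion.normSq_eq_norm_mul_self, hq]
  simp

theorem qi_mul_eq_neg_mul_qi {u : Quaternion ℝ} (hure : u.re = 0) (huI : u.imI = 0) :
    qi * u = -(u * qi) := by
  ext <;> simp [hure, huI]

theorem re_star_mul_qi_mul (q : Quaternion ℝ) : (star q * qi * q).re = 0 := by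
  simp
  ring

/-- The quaternion η̃·i·u·η is a unit vector orthogonal to η̃·u·η:
conj(η̃·i·u·η)·(η̃·u·η) = conj(η)·i·η, whose real part vanishes. -/
theorem rotated_normal_is_unit_orthogonal
    (η u : Quaternion ℝ)
    (hη : ‖η‖ = 1) (hu : ‖u‖ = 1) (hure : u.re = 0) (huI : u.imI = 0) :
    star (Iinv η * qi * u * η) * (Iinv η * u * η) = star η * qi * η ∧
    (star η * qi * η).re = 0 ∧
    ‖Iinv η * qi * u * η‖ = 1 ∧
    (star (Iinv η * qi * u * η) * (Iinv η * u * η)).re = 0 := by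
  have key : star (Iinv η * qi * u * η) * (Iinv η * u * η) = star η * qi * η := by
    calc star (Iinv η * qi * u * η) * (Iinv η * u * η)
        = star η * (star u * (star qi * (star (Iinv η) * Iinv η) * u)) * η := by
          simp only [star_mul, mul_assoc]
      _ = star η * (star u * u * qi) * η := by
          rw [star_mul_self_of_norm_eq_one ((norm_Iinv η).trans hη), mul_one, star_qi, neg_mul,
            qi_mul_eq_neg_mul_qi hure huI, neg_neg, mul_assoc (star u)]
      _ = star η * qi * η := by rw [star_mul_self_of_norm_eq_one hu, one_mul]
  refine ⟨key, re_star_mul_qi_mul η, ?_, key ▸ re_star_mul_qi_mul η⟩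
  simp only [norm_mul, norm_Iinv, norm_qi, hη, hu, mul_one]
end
end

section
/- Let η, u: ℝ → ℍ be differentiable curves such that for all s: |u(s)| = 1, u(s) ∈ span{j,k} (real part and i-component vanish), η'(s) = u(s)·η(s), and u'(s) = 2·i·κ(s)·u(s) for some function κ: ℝ → ℝ. Then for every fixed φ ∈ ℝ the quaternion-valued function N(s) := i·u(s)·e^{−iφ}·η(s) satisfies N'(s) = −2κ(s)·e^{iφ}·u(s)·η(s) − i·e^{iφ}·η(s) for all s ∈ ℝ (i.e. ∂_sN = −2κ·∂_sX − ∂_φX for the Hopf-torus parametrization X(s,φ) = e^{iφ}·η(s)). -/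
noncomputable section

theorem qi_mul_qi : qi * qi = -1 := by
  ext <;> simp [Quaternion.re_mul, Quaternion.imI_mul, Quaternion.imJ_mul,
    Quaternion.imK_mul, Quaternion.re_one, Quaternion.imI_one,
    Quaternion.imJ_one, Quaternion.imK_one] <;> simp [qi]

theorem Quaternion.mul_expMI_of_re_of_imI {v : Quaternion ℝ} (hre : v.re = 0) (hI : v.imI = 0)
    (φ : ℝ) : v * expMI φ = expI φ * v := by
  ext <;> simp only [Quaternion.re_mul, Quaternion.imI_mul, Quaternion.imJ_mul,
    Quaternion.imK_mul, hre, hI] <;>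
    simp only [expI, expMI] <;> ring

theorem Quaternion.mul_self_of_norm_of_re {v : Quaternion ℝ} (hnorm : ‖v‖ = 1)
    (hre : v.re = 0) : v * v = -1 := by
  have hstar : star v = -v := by ext <;> simp [hre]
  have h : v * star v = 1 := by
    rw [Quaternion.self_mul_star, Quaternion.normSq_eq_norm_mul_self, hnorm]
    simp
  rw [hstar, mul_neg] at h
  rw [← h, neg_neg]

/-- Derivative of the unit normal along the Hopf torus:
∂_s N = −2κ·∂_sX − ∂_φX, where N(s) = i·u(s)·e^{−iφ}·η(s) and
X(s,φ) = e^{iφ}·η(s). -/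
theorem unit_normal_derivative
    (η u : ℝ → Quaternion ℝ) (κ : ℝ → ℝ)
    (hu_norm : ∀ s, ‖u s‖ = 1)
    (hu_re : ∀ s, (u s).re = 0)
    (hu_imI : ∀ s, (u s).imI = 0)
    (hη : ∀ s, HasDerivAt η (u s * η s) s)
    (hu : ∀ s, HasDerivAt u ((2 * κ s) • (qi * u s)) s)
    (φ : ℝ) :
    ∀ s : ℝ,
      HasDerivAt (fun t => qi * u t * expMI φ * η t)
        (-((2 * κ s) • (expI φ * u s * η s)) - qi * expI φ * η s) s := by
  intro s
  have hcomm := Quaternion.mul_expMI_of_re_of_imI (hu_re s) (hu_imI s) φ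
  have hsq := Quaternion.mul_self_of_norm_of_re (hu_norm s) (hu_re s)
  have hκ : qi * ((2 * κ s) • (qi * u s)) * expMI φ * η s
      = -((2 * κ s) • (expI φ * u s * η s)) := by
    rw [mul_smul_comm, ← mul_assoc qi qi, qi_mul_qi, smul_mul_assoc, smul_mul_assoc,
      neg_one_mul, neg_mul, hcomm, neg_mul, smul_neg]
  have hφ : qi * u s * expMI φ * (u s * η s) = -(qi * expI φ * η s) := by
    rw [mul_assoc qi, hcomm]
    calc qi * (expI φ * u s) * (u s * η s) = qi * expI φ * (u s * u s) * η s := by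
          simp only [mul_assoc]
      _ = -(qi * expI φ * η s) := by rw [hsq, mul_neg_one, neg_mul]
  have h := (((hu s).const_mul qi).mul_const (expMI φ)).mul (hη s)
  rw [hκ, hφ, ← sub_eq_add_neg] at h
  exact h
end
end

section
/- The value of the second Eisenstein series at τ = i equals π; concretely, π²/3 − 8π²·∑_{n=1}^{∞} σ₁(n)·e^{−2πn} = π, where σ₁(n) = ∑_{d ∣ n} d is the sum-of-divisors function. -/
open Real

open UpperHalfPlane in
/-- `τ = i` is a fixed point of `τ ↦ -1 / τ`. -/
lemma modularGroup_S_smul_I : ModularGroup.S • UpperHalfPlane.I = UpperHalfPlane.I := by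
  ext1
  rw [modular_S_smul]
  simp

/-- The modular transformation law under `τ ↦ -1 / τ` determines `G2` at the fixed point `i`. -/
lemma eisensteinSeries_G2_I : EisensteinSeries.G2 UpperHalfPlane.I = π := by
  have h := EisensteinSeries.G2_S_transform UpperHalfPlane.I
  rw [modularGroup_S_smul_I] at h
  simp only [UpperHalfPlane.coe_I, Complex.I_sq] at h
  field_simp at h
  linear_combination h / 2

lemma cexp_two_pi_I_mul_I_pow (n : ℕ) :
    Complex.exp (2 * π * Complex.I * Complex.I) ^ n = (Real.exp (-(2 * π * n)) : ℝ) := by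
  rw [← Complex.exp_nat_mul, Complex.ofReal_exp]
  congr 1
  push_cast
  linear_combination (2 * π * n : ℂ) * Complex.I_sq

/-- The value of the second Eisenstein series at τ = i equals π:
π²/3 − 8π²·∑_{n≥1} σ₁(n)·e^{−2πn} = π, where σ₁(n) = ∑_{d∣n} d. -/
theorem eisenstein_G2_at_i :
    π ^ 2 / 3 -
      8 * π ^ 2 *
        ∑' n : ℕ, ((∑ d ∈ (n + 1).divisors, d : ℕ) : ℝ) *
          Real.exp (-(2 * π * (n + 1))) = π := by
  have h := EisensteinSeries.G2_eq_tsum_cexp (z := UpperHalfPlane.I)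
  rw [eisensteinSeries_G2_I, riemannZeta_two, UpperHalfPlane.coe_I,
    tsum_pnat_eq_tsum_succ (f := fun n : ℕ ↦ (ArithmeticFunction.sigma 1 n : ℂ) *
      Complex.exp (2 * π * Complex.I * Complex.I) ^ n)] at h
  simp only [cexp_two_pi_I_mul_I_pow, ArithmeticFunction.sigma_one_apply] at h
  apply Complex.ofReal_injective
  rw [h]
  push_cast
  ring
end
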